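/- arXiv:1203.0904 — 4 statements merged into one kernel-verified Lean document; each statement's English description precedes it below -/
import Mathlib

section
/- Under the hyperbolicity hypotheses, ∑_{ℓ=0}^{n} (−1)^{ℓ+k} · tr(Λ^ℓ A) = sign(det(A|_E)) · |det(id_V − A)|, where Λ^ℓ A denotes the endomorphism induced by A on the ℓ-th exterior power of V (with tr(Λ^0 A) = 1). Equivalently, setting χ_ℓ := tr(Λ^ℓ A) / ( ε · |det(id_V − A)| ) with ε := sign(det(A|_E)), one has ∑_{ℓ=0}^{n} (−1)^{ℓ+k} χ_ℓ = 1. (This is the per-orbit identity underlying the product formula (2.8) expressing ζ_Ruelle as the alternating product of the dynamical determinants 𝔇_ℓ.) -/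
/-- The linear map `⋀^ℓ A` induced by an endomorphism `A` on the `ℓ`-th exterior power. -/
noncomputable def exteriorPowerMap {R M : Type*} [CommRing R] [AddCommGroup M] [Module R M]
    (ℓ : ℕ) (A : M →ₗ[R] M) : (⋀[R]^ℓ M) →ₗ[R] (⋀[R]^ℓ M) :=
  LinearMap.restrict (ExteriorAlgebra.map A).toLinearMap
    (fun x hx => by
      have hmap : Submodule.map (ExteriorAlgebra.map A).toLinearMap (⋀[R]^ℓ M) ≤ ⋀[R]^ℓ M := by
        rw [ExteriorAlgebra.exteriorPower, Submodule.map_pow, ExteriorAlgebra.ι_range_map_map]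
        exact pow_le_pow_left' (LinearMap.map_le_range) ℓ
      exact hmap ⟨x, hx, rfl⟩)

open Module Set.powersetCard in
/-- The trace of the map induced on the `ℓ`-th exterior power is the sum of the principal
minors of size `ℓ` of any matrix of the endomorphism. -/
theorem trace_exteriorPowerMap_eq_sum_minors {R M I : Type*} [CommRing R] [AddCommGroup M]
    [Module R M] [Fintype I] [LinearOrder I] (b : Basis I R M) (ℓ : ℕ) (A : M →ₗ[R] M) :
    LinearMap.trace R (⋀[R]^ℓ M) (exteriorPowerMap ℓ A) =
      ∑ s ∈ Finset.univ.powersetCard ℓ,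
        ((LinearMap.toMatrix b b A).submatrix (Subtype.val : s → I) (Subtype.val : s → I)).det := by
  classical
  rw [LinearMap.trace_eq_matrix_trace R (b.exteriorPower ℓ), Matrix.trace]
  have hmap (v : Fin ℓ → M) : exteriorPowerMap ℓ A (exteriorPower.ιMulti R ℓ v) =
      exteriorPower.ιMulti R ℓ (A ∘ v) := by
    apply Subtype.ext
    change ExteriorAlgebra.map A (ExteriorAlgebra.ιMulti R ℓ v) = _
    simp [ExteriorAlgebra.map_apply_ιMulti]
  have hdiag (s : Set.powersetCard I ℓ) :
      (LinearMap.toMatrix (b.exteriorPower ℓ) (b.exteriorPower ℓ) (exteriorPowerMap ℓ A)).diag s =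
        ((LinearMap.toMatrix b b A).submatrix
          (Subtype.val : s.val → I) (Subtype.val : s.val → I)).det := by
    rw [Matrix.diag_apply, LinearMap.toMatrix_apply, exteriorPower.basis_repr_apply,
      exteriorPower.basis_apply, exteriorPower.ιMulti_family, hmap,
      exteriorPower.ιMultiDual_apply_ιMulti, ← Matrix.det_transpose,
      ← Matrix.det_submatrix_equiv_self (s.val.orderIsoOfFin s.prop).toEquiv]
    congr 1
    ext i j
    simp [LinearMap.toMatrix_apply, ofFinEmbEquiv_symm_apply]
    rfl
  simp_rw [hdiag]
  refine Finset.sum_bij (fun s _ => s.val) ?_ ?_ ?_ ?_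
  · intro s _
    exact Finset.mem_powersetCard.mpr ⟨Finset.subset_univ _, s.prop⟩
  · intro s _ t _ h
    exact Subtype.ext h
  · intro s hs
    exact ⟨⟨s, (Finset.mem_powersetCard.mp hs).2⟩, Finset.mem_univ _, rfl⟩
  · intro s _
    rfl

/-- The alternating sum of the traces on the exterior powers of `A` is `det (id - A)`. -/
theorem sum_neg_one_pow_mul_trace_exteriorPowerMap {K V : Type*} [Field K] [AddCommGroup V]
    [Module K V] [FiniteDimensional K V] (A : V →ₗ[K] V) :
    ∑ ℓ ∈ Finset.range (Module.finrank K V + 1),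
        (-1 : K) ^ ℓ * LinearMap.trace K (⋀[K]^ℓ V) (exteriorPowerMap ℓ A) =
      LinearMap.det (LinearMap.id - A) := by
  let b := Module.finBasis K V
  let M := LinearMap.toMatrix b b A
  have hdet : LinearMap.det (LinearMap.id - A) = M.charpoly.eval 1 := by
    rw [Matrix.eval_charpoly, ← LinearMap.det_toMatrix b]
    simp [M]
  rw [hdet, Polynomial.eval_eq_sum_range, Matrix.charpoly_natDegree_eq_dim, Fintype.card_fin,
    ← Finset.sum_range_reflect (fun j => M.charpoly.coeff j * 1 ^ j)]
  refine Finset.sum_congr rfl fun ℓ hℓ => ?_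
  have hcoeff := M.charpoly_coeff_eq_sum_minors ℓ
    (by rw [Fintype.card_fin]; exact Nat.lt_succ_iff.mp (Finset.mem_range.mp hℓ))
  rw [Fintype.card_fin] at hcoeff
  rw [trace_exteriorPowerMap_eq_sum_minors b, one_pow, mul_one, Nat.add_sub_cancel, hcoeff]

/-- The determinant of an endomorphism preserving two complementary subspaces is the product of
the determinants of its restrictions. -/
theorem LinearMap.det_eq_det_restrict_mul_det_restrict {K V : Type*} [Field K] [AddCommGroup V]
    [Module K V] [FiniteDimensional K V] {E F : Submodule K V} (hEF : IsCompl E F)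
    (B : V →ₗ[K] V) (hE : ∀ x ∈ E, B x ∈ E) (hF : ∀ x ∈ F, B x ∈ F) :
    LinearMap.det B = LinearMap.det (B.restrict hE) * LinearMap.det (B.restrict hF) := by
  rw [← LinearMap.det_prodMap,
    ← LinearMap.det_conj _ (Submodule.prodEquivOfIsCompl E F hEF)]
  congr 1
  rw [← LinearMap.comp_assoc, LinearEquiv.eq_comp_toLinearMap_symm]
  ext <;> simp

/-- If every map on the segment from `B` to `B + C` is injective, then the determinants of the
endpoints have the same sign. -/
theorem LinearMap.det_mul_det_add_pos {W : Type*} [AddCommGroup W] [Module ℝ W]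
    [FiniteDimensional ℝ W] (B C : W →ₗ[ℝ] W)
    (h : ∀ t ∈ Set.Icc (0 : ℝ) 1, ∀ v, B v + t • C v = 0 → v = 0) :
    0 < LinearMap.det B * LinearMap.det (B + C) := by
  let b := Module.finBasis ℝ W
  let f : ℝ → ℝ := fun t => LinearMap.det (B + t • C)
  have hf : Continuous f := by
    have : f = fun t => (LinearMap.toMatrix b b B + t • LinearMap.toMatrix b b C).det := by
      funext t
      simp only [f]
      rw [← LinearMap.det_toMatrix b, map_add, map_smul]
    rw [this]
    fun_prop
  have hne : ∀ t ∈ Set.Icc (0 : ℝ) 1, f t ≠ 0 := by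
    intro t ht h0
    obtain ⟨v, hv, hv0⟩ := (Submodule.ne_bot_iff _).mp
      (LinearMap.bot_lt_ker_of_det_eq_zero h0).ne'
    exact hv0 (h t ht v (by simpa using hv))
  have h01 : 0 < f 0 * f 1 := by
    by_contra! hle
    have hmem : (0 : ℝ) ∈ Set.uIcc (f 0) (f 1) := by
      rw [Set.mem_uIcc]
      rcases mul_nonpos_iff.mp hle with h' | h'
      · exact Or.inr ⟨h'.2, h'.1⟩
      · exact Or.inl h'
    obtain ⟨t, ht, ht0⟩ := intermediate_value_uIcc hf.continuousOn hmem
    exact hne t (by rwa [Set.uIcc_of_le zero_le_one] at ht) ht0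
  simpa [f] using h01

/-- An eigenvector relation `A v = t • v` iterates to `A ^ m v = t ^ m • v`. -/
theorem LinearMap.pow_apply_of_apply_eq_smul {R M : Type*} [CommSemiring R] [AddCommMonoid M]
    [Module R M] {A : M →ₗ[R] M} {t : R} {v : M} (h : A v = t • v) (m : ℕ) :
    (A ^ m) v = t ^ m • v := by
  induction m with
  | zero => simp
  | succ m ih => rw [pow_succ, Module.End.mul_apply, h, map_smul, ih, smul_smul, pow_succ']

/-- An expanding map has no eigenvector with eigenvalue in `[0, 1]`. -/
theorem eq_zero_of_expanding_of_apply_eq_smul {V : Type*} [NormedAddCommGroup V]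
    [NormedSpace ℝ V] {A : V →ₗ[ℝ] V} {c μ : ℝ} (hc : 0 < c) (hμ : 1 < μ) {v : V}
    (hexp : ∀ m : ℕ, c * μ ^ m * ‖v‖ ≤ ‖(A ^ m) v‖) {t : ℝ} (ht : t ∈ Set.Icc (0 : ℝ) 1)
    (h : A v = t • v) : v = 0 := by
  by_contra hv
  have hv' : 0 < ‖v‖ := norm_pos_iff.mpr hv
  obtain ⟨m, hm⟩ := pow_unbounded_of_one_lt c⁻¹ hμ
  have h1 := hexp m
  rw [LinearMap.pow_apply_of_apply_eq_smul h, norm_smul, Real.norm_of_nonneg (pow_nonneg ht.1 m)]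
    at h1
  have h2 : c * μ ^ m ≤ t ^ m := le_of_mul_le_mul_right h1 hv'
  have h3 : t ^ m ≤ 1 := pow_le_one₀ ht.1 ht.2
  have h4 : 1 < c * μ ^ m := by rwa [inv_lt_iff_one_lt_mul₀' hc] at hm
  linarith

/-- A contracting map `A` has no nonzero vector with `v = t • A v` and `t ∈ [0, 1]`. -/
theorem eq_zero_of_contracting_of_eq_smul_apply {V : Type*} [NormedAddCommGroup V]
    [NormedSpace ℝ V] {A : V →ₗ[ℝ] V} {c μ : ℝ} (hμ : 1 < μ) {v : V}
    (hcon : ∀ m : ℕ, ‖(A ^ m) v‖ ≤ c⁻¹ * (μ ^ m)⁻¹ * ‖v‖) {t : ℝ} (ht : t ∈ Set.Icc (0 : ℝ) 1)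
    (h : v = t • A v) : v = 0 := by
  by_contra hv
  have hv' : 0 < ‖v‖ := norm_pos_iff.mpr hv
  obtain ⟨m, hm⟩ := pow_unbounded_of_one_lt c⁻¹ hμ
  have hpow : v = t ^ m • (A ^ m) v := by
    have := LinearMap.pow_apply_of_apply_eq_smul (A := t • A) (t := (1 : ℝ)) (v := v)
      (by simpa using h.symm) m
    simpa [smul_pow] using this.symm
  have h1 : ‖v‖ ≤ ‖(A ^ m) v‖ := by
    conv_lhs => rw [hpow, norm_smul, Real.norm_of_nonneg (pow_nonneg ht.1 m)]
    exact mul_le_of_le_one_left (norm_nonneg _) (pow_le_one₀ ht.1 ht.2)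
  have h2 : c⁻¹ * (μ ^ m)⁻¹ < 1 := by
    rwa [← div_eq_mul_inv, div_lt_one (by positivity)]
  have h3 := mul_lt_mul_of_pos_right h2 hv'
  linarith [hcon m]

/-- under the hyperbolicity hypotheses,
`∑_{ℓ=0}^{n} (−1)^{ℓ+k} · tr (⋀^ℓ A) = sign (det (A|_E)) · |det (id − A)|`,
the per-orbit identity underlying the product formula (2.8) of the paper. -/
theorem stmt_5 {V : Type*} [NormedAddCommGroup V] [NormedSpace ℝ V] [FiniteDimensional ℝ V]
    (A : V →ₗ[ℝ] V) (E F : Submodule ℝ V) (hEF : IsCompl E F)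
    (hAE : ∀ x ∈ E, A x ∈ E) (hAF : ∀ x ∈ F, A x ∈ F)
    (k : ℕ) (hk : Module.finrank ℝ E = k)
    (c μ : ℝ) (hc0 : 0 < c) (hc1 : c ≤ 1) (hμ : 1 < μ)
    (hexp : ∀ v ∈ E, ∀ m : ℕ, c * μ ^ m * ‖v‖ ≤ ‖(A ^ m) v‖)
    (hcon : ∀ w ∈ F, ∀ m : ℕ, ‖(A ^ m) w‖ ≤ c⁻¹ * (μ ^ m)⁻¹ * ‖w‖) :
    ∑ ℓ ∈ Finset.range (Module.finrank ℝ V + 1),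
        (-1 : ℝ) ^ (ℓ + k) * LinearMap.trace ℝ (⋀[ℝ]^ℓ V) (exteriorPowerMap ℓ A) =
      Real.sign (LinearMap.det (LinearMap.restrict A hAE)) *
        |LinearMap.det (LinearMap.id - A)| := by
  have hdetE : 0 < LinearMap.det (-(A.restrict hAE)) *
      LinearMap.det (LinearMap.id - A.restrict hAE) := by
    have := LinearMap.det_mul_det_add_pos (-(A.restrict hAE)) LinearMap.id fun t ht v hv => by
      refine Subtype.ext (eq_zero_of_expanding_of_apply_eq_smul hc0 hμ (hexp v v.2) ht ?_)
      simpa using congrArg Subtype.val (neg_add_eq_zero.mp hv)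
    rwa [neg_add_eq_sub] at this
  have hdetF : 0 < LinearMap.det (LinearMap.id - A.restrict hAF) := by
    have := LinearMap.det_mul_det_add_pos LinearMap.id (-(A.restrict hAF)) fun t ht v hv => by
      refine Subtype.ext (eq_zero_of_contracting_of_eq_smul_apply hμ (hcon v v.2) ht ?_)
      rw [LinearMap.neg_apply, smul_neg, ← sub_eq_add_neg, sub_eq_zero] at hv
      simpa using congrArg Subtype.val hv
    rwa [LinearMap.det_id, one_mul, ← sub_eq_add_neg] at this
  have hdet : LinearMap.det (LinearMap.id - A) =
      LinearMap.det (LinearMap.id - A.restrict hAE) *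
        LinearMap.det (LinearMap.id - A.restrict hAF) :=
    LinearMap.det_eq_det_restrict_mul_det_restrict hEF (LinearMap.id - A)
      (fun x hx => E.sub_mem hx (hAE x hx)) (fun x hx => F.sub_mem hx (hAF x hx))
  have hneg : LinearMap.det (-(A.restrict hAE)) = (-1) ^ k * LinearMap.det (A.restrict hAE) := by
    rw [← neg_one_smul ℝ (A.restrict hAE), LinearMap.det_smul, hk]
  have hsum : ∑ ℓ ∈ Finset.range (Module.finrank ℝ V + 1),
      (-1 : ℝ) ^ (ℓ + k) * LinearMap.trace ℝ (⋀[ℝ]^ℓ V) (exteriorPowerMap ℓ A) =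
        (-1) ^ k * LinearMap.det (LinearMap.id - A) := by
    rw [← sum_neg_one_pow_mul_trace_exteriorPowerMap, Finset.mul_sum]
    exact Finset.sum_congr rfl fun ℓ _ => by ring
  rw [hsum, hdet, abs_mul, abs_of_pos hdetF, ← mul_assoc, ← mul_assoc]
  congr 1
  rw [hneg] at hdetE
  rcases neg_one_pow_eq_or ℝ k with hs | hs <;>
    rcases lt_trichotomy (LinearMap.det (A.restrict hAE)) 0 with hd | hd | hd <;>
    rw [hs] at hdetE ⊢
  · rw [Real.sign_of_neg hd, abs_of_neg (by nlinarith)]; ring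
  · simp [hd] at hdetE
  · rw [Real.sign_of_pos hd, abs_of_pos (by nlinarith)]
  · rw [Real.sign_of_neg hd, abs_of_pos (by nlinarith)]
  · simp [hd] at hdetE
  · rw [Real.sign_of_pos hd, abs_of_neg (by nlinarith)]; ring
end

section
/- For all real a > 0, b ≥ 0 and every integer n ≥ 1: ∫_0^∞ ∫_0^∞ (t·s)^{n−1} · e^{−a(t+s) − b·min(t,s)} dt ds ≤ 2·((n−1)!)^2 · a^{−n} · (a+b)^{−n}. (This is the double Laplace-integral estimate proved in Lemma 5.2 for the powers of the tensorial resolvent R_2(z)^n, with a = Re(z) − σ_ℓ and b = σ_{p,q}.) -/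
open MeasureTheory

lemma integral_pow_mul_exp_neg_mul_Ioi {a : ℝ} (ha : 0 < a) (m : ℕ) :
    ∫ t in Set.Ioi (0 : ℝ), t ^ m * Real.exp (-(a * t)) = m.factorial / a ^ (m + 1) := by
  have h := Real.integral_rpow_mul_exp_neg_mul_Ioi (a := (m : ℝ) + 1) (by positivity) ha
  simp only [add_sub_cancel_right, Real.rpow_natCast, Real.Gamma_nat_eq_factorial] at h
  rw [h, ← Nat.cast_add_one, Real.rpow_natCast, one_div, inv_pow, div_eq_inv_mul]

lemma integrableOn_pow_mul_exp_neg_mul_Ioi {a : ℝ} (ha : 0 < a) (m : ℕ) :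
    IntegrableOn (fun t : ℝ => t ^ m * Real.exp (-(a * t))) (Set.Ioi 0) := by
  refine not_imp_comm.1 integral_undef ?_
  rw [integral_pow_mul_exp_neg_mul_Ioi ha]
  positivity

lemma mul_pow_mul_exp_min_le {a b t s : ℝ} (ht : 0 < t) (hs : 0 < s) (m : ℕ) :
    (t * s) ^ m * Real.exp (-a * (t + s) - b * min t s) ≤
      t ^ m * Real.exp (-((a + b) * t)) * (s ^ m * Real.exp (-(a * s))) +
        t ^ m * Real.exp (-(a * t)) * (s ^ m * Real.exp (-((a + b) * s))) := by
  have key : Real.exp (-a * (t + s) - b * min t s) ≤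
      Real.exp (-((a + b) * t)) * Real.exp (-(a * s)) +
        Real.exp (-(a * t)) * Real.exp (-((a + b) * s)) := by
    rw [← Real.exp_add, ← Real.exp_add]
    rcases min_choice t s with h | h <;> rw [h]
    · exact le_add_of_le_of_nonneg (Real.exp_le_exp.2 (by linarith)) (Real.exp_nonneg _)
    · exact le_add_of_nonneg_of_le (Real.exp_nonneg _) (Real.exp_le_exp.2 (by linarith))
  calc _ ≤ (t * s) ^ m * _ := mul_le_mul_of_nonneg_left key (by positivity)
    _ = _ := by ring

/-- the double Laplace-integral estimate of Lemma 5.2: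
`∫_0^∞∫_0^∞ (ts)^{n−1} e^{−a(t+s)−b·min(t,s)} dt ds ≤ 2 ((n−1)!)² a^{−n} (a+b)^{−n}`. -/
theorem stmt_7 (a b : ℝ) (ha : 0 < a) (hb : 0 ≤ b) (n : ℕ) (hn : 1 ≤ n) :
    (∫ t in Set.Ioi (0 : ℝ), ∫ s in Set.Ioi (0 : ℝ),
        (t * s) ^ (n - 1) * Real.exp (-a * (t + s) - b * min t s)) ≤
      2 * ((n - 1).factorial : ℝ) ^ 2 / (a ^ n * (a + b) ^ n) := by
  obtain ⟨m, rfl⟩ := Nat.exists_eq_add_of_le' hn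
  rw [Nat.add_sub_cancel]
  have hab : 0 < a + b := by linarith
  have hIa := integrableOn_pow_mul_exp_neg_mul_Ioi ha m
  have hIc := integrableOn_pow_mul_exp_neg_mul_Ioi hab m
  have inner_le : ∀ t ∈ Set.Ioi (0 : ℝ),
      ∫ s in Set.Ioi (0 : ℝ), (t * s) ^ m * Real.exp (-a * (t + s) - b * min t s) ≤
        t ^ m * Real.exp (-((a + b) * t)) * (m.factorial / a ^ (m + 1)) +
          t ^ m * Real.exp (-(a * t)) * (m.factorial / (a + b) ^ (m + 1)) := by
    intro t ht
    rw [← integral_pow_mul_exp_neg_mul_Ioi ha, ← integral_pow_mul_exp_neg_mul_Ioi hab,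
      ← integral_const_mul, ← integral_const_mul,
      ← integral_add (hIa.const_mul _) (hIc.const_mul _)]
    refine integral_mono_of_nonneg ?_ ((hIa.const_mul _).add (hIc.const_mul _)) ?_
    · filter_upwards [ae_restrict_mem measurableSet_Ioi] with s hs
      exact mul_nonneg (pow_nonneg (mul_pos ht hs).le _) (Real.exp_nonneg _)
    · filter_upwards [ae_restrict_mem measurableSet_Ioi] with s hs
      exact mul_pow_mul_exp_min_le ht hs m
  calc _ ≤ ∫ t in Set.Ioi (0 : ℝ),
        (t ^ m * Real.exp (-((a + b) * t)) * (m.factorial / a ^ (m + 1)) +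
          t ^ m * Real.exp (-(a * t)) * (m.factorial / (a + b) ^ (m + 1))) := by
        refine integral_mono_of_nonneg ?_ ((hIc.mul_const _).add (hIa.mul_const _)) ?_
        · filter_upwards [ae_restrict_mem measurableSet_Ioi] with t ht
          exact setIntegral_nonneg measurableSet_Ioi fun s hs =>
            mul_nonneg (pow_nonneg (mul_pos ht hs).le _) (Real.exp_nonneg _)
        · filter_upwards [ae_restrict_mem measurableSet_Ioi] with t ht
          exact inner_le t ht
    _ = _ := by
        rw [integral_add (hIc.mul_const _) (hIa.mul_const _), integral_mul_const,
          integral_mul_const, integral_pow_mul_exp_neg_mul_Ioi ha,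
          integral_pow_mul_exp_neg_mul_Ioi hab]
        field_simp
        ring
end

section
/- Let m ∈ ℕ. (a) There exist unique real numbers b_0, …, b_m such that ∑_{k=0}^{m} b_k·(−2^k)^j = 1 for every j ∈ {0,…,m} (the relevant Vandermonde determinant is nonzero). (b) With these b_k (independent of f), for every f : ℝ → ℝ that is C^m on [0,1], the function g defined by g(x) = f(x) for x ∈ [0,1] and g(x) = ∑_{k=0}^{m} b_k·f(−2^k·x) for x ∈ [−2^{−m}, 0) is C^m on [−2^{−m}, 1], and there is a constant K_m (independent of f) such that for each j ≤ m, sup_{[−2^{−m},1]} |g^{(j)}| ≤ K_m · max_{j'≤m} sup_{[0,1]} |f^{(j')}|. (This is the one-dimensional reflection-extension construction at the heart of Lemma 4.1 (lem:extension), following Lichtenstein–Hestenes–Seeley.) -/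
/-- Reflection of `u` across `0` with weights `c` and dilations `-2 ^ k`. -/
noncomputable def reflect {m : ℕ} (c : Fin (m + 1) → ℝ) (u : ℝ → ℝ) (x : ℝ) : ℝ :=
  if 0 ≤ x then u x else ∑ k : Fin (m + 1), c k * u (-(2 : ℝ) ^ (k : ℕ) * x)

theorem reflect_of_nonneg {m : ℕ} (c : Fin (m + 1) → ℝ) (u : ℝ → ℝ) {x : ℝ} (hx : 0 ≤ x) :
    reflect c u x = u x :=
  if_pos hx

theorem reflect_of_nonpos {m : ℕ} {c : Fin (m + 1) → ℝ} (hc : ∑ k, c k = 1) (u : ℝ → ℝ) {x : ℝ}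
    (hx : x ≤ 0) :
    reflect c u x = ∑ k : Fin (m + 1), c k * u (-(2 : ℝ) ^ (k : ℕ) * x) := by
  rcases hx.eq_or_lt with rfl | hx
  · simp [reflect, ← Finset.sum_mul, hc]
  · exact if_neg hx.not_ge

theorem mapsTo_neg_two_pow_mul {m k : ℕ} (hk : k ≤ m) :
    Set.MapsTo (fun x : ℝ => -(2 : ℝ) ^ k * x) (Set.Icc (-((2 : ℝ) ^ m)⁻¹) 0) (Set.Icc 0 1) := by
  rintro x ⟨hx, hx0⟩
  have hkm : (2 : ℝ) ^ k ≤ 2 ^ m := pow_le_pow_right₀ one_le_two hk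
  refine ⟨by nlinarith [pow_pos (two_pos (α := ℝ)) k], ?_⟩
  calc -(2 : ℝ) ^ k * x = 2 ^ k * -x := by ring
    _ ≤ 2 ^ m * ((2 : ℝ) ^ m)⁻¹ := by gcongr <;> linarith
    _ = 1 := by field_simp

theorem Icc_union_Icc_reflect (m : ℕ) :
    Set.Icc (-((2 : ℝ) ^ m)⁻¹) 0 ∪ Set.Icc 0 1 = Set.Icc (-((2 : ℝ) ^ m)⁻¹) 1 :=
  Set.Icc_union_Icc_eq_Icc (by simp) zero_le_one

theorem continuousOn_reflect {m : ℕ} {c : Fin (m + 1) → ℝ} (hc : ∑ k, c k = 1) {u : ℝ → ℝ}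
    (hu : ContinuousOn u (Set.Icc 0 1)) :
    ContinuousOn (reflect c u) (Set.Icc (-((2 : ℝ) ^ m)⁻¹) 1) := by
  rw [← Icc_union_Icc_reflect]
  refine ContinuousOn.union_of_isClosed ?_ ?_ isClosed_Icc isClosed_Icc
  · refine ContinuousOn.congr (continuousOn_finsetSum _ fun k _ => ?_)
      fun x hx => reflect_of_nonpos hc u hx.2
    exact continuousOn_const.mul (hu.comp (by fun_prop)
      (mapsTo_neg_two_pow_mul (Nat.le_of_lt_succ k.2)))
  · exact hu.congr fun x hx => reflect_of_nonneg c u hx.1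

theorem hasDerivWithinAt_reflect {m : ℕ} {c : Fin (m + 1) → ℝ} (hc : ∑ k, c k = 1)
    (hc' : ∑ k, c k * -(2 : ℝ) ^ (k : ℕ) = 1) {u u' : ℝ → ℝ}
    (hu : ∀ y ∈ Set.Icc (0 : ℝ) 1, HasDerivWithinAt u (u' y) (Set.Icc 0 1) y) {x : ℝ}
    (hx : x ∈ Set.Icc (-((2 : ℝ) ^ m)⁻¹) 1) :
    HasDerivWithinAt (reflect c u) (reflect (fun k => c k * -(2 : ℝ) ^ (k : ℕ)) u' x)
      (Set.Icc (-((2 : ℝ) ^ m)⁻¹) 1) x := by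
  rw [← Icc_union_Icc_reflect]
  refine HasDerivWithinAt.union ?_ ?_
  · rcases le_or_gt x 0 with h0 | h0
    · have hxs : x ∈ Set.Icc (-((2 : ℝ) ^ m)⁻¹) 0 := ⟨hx.1, h0⟩
      rw [reflect_of_nonpos hc' u' h0]
      refine HasDerivWithinAt.congr (HasDerivWithinAt.fun_sum fun k _ => ?_)
        (fun y hy => reflect_of_nonpos hc u hy.2) (reflect_of_nonpos hc u h0)
      have hmap := mapsTo_neg_two_pow_mul (Nat.le_of_lt_succ k.2)
      have hlin : HasDerivWithinAt (fun y : ℝ => -(2 : ℝ) ^ (k : ℕ) * y) (-(2 : ℝ) ^ (k : ℕ))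
          (Set.Icc (-((2 : ℝ) ^ m)⁻¹) 0) x := by
        simpa using (hasDerivWithinAt_id x _).const_mul (-(2 : ℝ) ^ (k : ℕ))
      exact (((hu _ (hmap hxs)).comp x hlin hmap).const_mul (c k)).congr_deriv (by ring)
    · exact HasFDerivWithinAt.of_notMem_closure (by simp [h0])
  · rcases le_or_gt 0 x with h0 | h0
    · rw [reflect_of_nonneg _ _ h0]
      exact (hu x ⟨h0, hx.2⟩).congr (fun y hy => reflect_of_nonneg c u hy.1)
        (reflect_of_nonneg c u h0)
    · exact HasFDerivWithinAt.of_notMem_closure (by simp [h0])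

theorem uniqueDiffOn_Icc_reflect (m : ℕ) :
    UniqueDiffOn ℝ (Set.Icc (-((2 : ℝ) ^ m)⁻¹) 1) :=
  uniqueDiffOn_Icc (by linarith [show (0 : ℝ) < ((2 : ℝ) ^ m)⁻¹ by positivity])

section

variable {m : ℕ} {b : Fin (m + 1) → ℝ} {f : ℝ → ℝ}

theorem hasDerivWithinAt_reflect_iteratedDerivWithin
    (hb : ∀ j ≤ m, ∑ k : Fin (m + 1), b k * (-(2 : ℝ) ^ (k : ℕ)) ^ j = 1)
    (hf : ContDiffOn ℝ m f (Set.Icc 0 1)) {j : ℕ} (hj : j < m) {x : ℝ}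
    (hx : x ∈ Set.Icc (-((2 : ℝ) ^ m)⁻¹) 1) :
    HasDerivWithinAt
      (reflect (fun k => b k * (-(2 : ℝ) ^ (k : ℕ)) ^ j) (iteratedDerivWithin j f (Set.Icc 0 1)))
      (reflect (fun k => b k * (-(2 : ℝ) ^ (k : ℕ)) ^ (j + 1))
        (iteratedDerivWithin (j + 1) f (Set.Icc 0 1)) x)
      (Set.Icc (-((2 : ℝ) ^ m)⁻¹) 1) x := by
  have hsucc : ∀ k : Fin (m + 1), b k * (-(2 : ℝ) ^ (k : ℕ)) ^ (j + 1) =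
      b k * (-(2 : ℝ) ^ (k : ℕ)) ^ j * -(2 : ℝ) ^ (k : ℕ) := fun k => by
    rw [pow_succ, mul_assoc]
  have hb' := hb (j + 1) hj
  simp only [hsucc] at hb' ⊢
  refine hasDerivWithinAt_reflect (hb j hj.le) hb' (fun y hy => ?_) hx
  rw [iteratedDerivWithin_succ]
  exact (hf.differentiableOn_iteratedDerivWithin (by exact_mod_cast hj)
    (uniqueDiffOn_Icc zero_lt_one) y hy).hasDerivWithinAt

theorem iteratedDerivWithin_reflect
    (hb : ∀ j ≤ m, ∑ k : Fin (m + 1), b k * (-(2 : ℝ) ^ (k : ℕ)) ^ j = 1)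
    (hf : ContDiffOn ℝ m f (Set.Icc 0 1)) {j : ℕ} (hj : j ≤ m) :
    Set.EqOn (iteratedDerivWithin j (reflect b f) (Set.Icc (-((2 : ℝ) ^ m)⁻¹) 1))
      (reflect (fun k => b k * (-(2 : ℝ) ^ (k : ℕ)) ^ j) (iteratedDerivWithin j f (Set.Icc 0 1)))
      (Set.Icc (-((2 : ℝ) ^ m)⁻¹) 1) := by
  induction j with
  | zero => intro x _; simp
  | succ j ih =>
    intro x hx
    rw [iteratedDerivWithin_succ, derivWithin_congr (ih (by omega)) (ih (by omega) hx)]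
    exact (hasDerivWithinAt_reflect_iteratedDerivWithin hb hf hj hx).derivWithin
      (uniqueDiffOn_Icc_reflect m x hx)

theorem contDiffOn_reflect
    (hb : ∀ j ≤ m, ∑ k : Fin (m + 1), b k * (-(2 : ℝ) ^ (k : ℕ)) ^ j = 1)
    (hf : ContDiffOn ℝ m f (Set.Icc 0 1)) :
    ContDiffOn ℝ m (reflect b f) (Set.Icc (-((2 : ℝ) ^ m)⁻¹) 1) := by
  refine (contDiffOn_nat_iff_continuousOn_differentiableOn_deriv
    (uniqueDiffOn_Icc_reflect m)).2 ⟨fun j hj => ?_, fun j hj => ?_⟩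
  · exact (continuousOn_reflect (hb j hj) (hf.continuousOn_iteratedDerivWithin
      (by exact_mod_cast hj) (uniqueDiffOn_Icc zero_lt_one))).congr
      (iteratedDerivWithin_reflect hb hf hj)
  · exact DifferentiableOn.congr (fun x hx =>
      (hasDerivWithinAt_reflect_iteratedDerivWithin hb hf hj hx).differentiableWithinAt)
      (iteratedDerivWithin_reflect hb hf hj.le)

end

theorem abs_reflect_le {m : ℕ} {c : Fin (m + 1) → ℝ} {u : ℝ → ℝ} {M : ℝ}
    (hu : ∀ y ∈ Set.Icc (0 : ℝ) 1, |u y| ≤ M) {x : ℝ}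
    (hx : x ∈ Set.Icc (-((2 : ℝ) ^ m)⁻¹) 1) :
    |reflect c u x| ≤ (1 + ∑ k, |c k|) * M := by
  have hM : 0 ≤ M := (abs_nonneg _).trans (hu 0 (by simp))
  have hsum : 0 ≤ ∑ k, |c k| := Finset.sum_nonneg fun k _ => abs_nonneg _
  rcases le_or_gt 0 x with h0 | h0
  · rw [reflect_of_nonneg c u h0]
    nlinarith [hu x ⟨h0, hx.2⟩]
  · rw [reflect, if_neg h0.not_ge]
    calc |∑ k : Fin (m + 1), c k * u (-(2 : ℝ) ^ (k : ℕ) * x)|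
        ≤ ∑ k : Fin (m + 1), |c k * u (-(2 : ℝ) ^ (k : ℕ) * x)| := Finset.abs_sum_le_sum_abs _ _
      _ ≤ ∑ k, |c k| * M := Finset.sum_le_sum fun k _ => by
          rw [abs_mul]
          gcongr
          exact hu _ (mapsTo_neg_two_pow_mul (Nat.le_of_lt_succ k.2) ⟨hx.1, h0.le⟩)
      _ ≤ (1 + ∑ k, |c k|) * M := by
          rw [← Finset.sum_mul]
          linarith

/-- The moment system for distinct nodes has exactly one solution. -/
theorem existsUnique_sum_mul_pow_eq_one {n : ℕ} {v : Fin n → ℝ} (hv : Function.Injective v) :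
    ∃! b : Fin n → ℝ, ∀ j : Fin n, ∑ k, b k * v k ^ (j : ℕ) = 1 := by
  have hdet : IsUnit (Matrix.vandermonde v) := by
    rw [Matrix.isUnit_iff_isUnit_det, isUnit_iff_ne_zero]
    exact Matrix.det_vandermonde_ne_zero_iff.2 hv
  have key : ∀ b : Fin n → ℝ, (∀ j : Fin n, ∑ k, b k * v k ^ (j : ℕ) = 1) ↔
      Matrix.vecMul b (Matrix.vandermonde v) = 1 := fun b => by
    simp [funext_iff, Matrix.vecMul, dotProduct, Matrix.vandermonde_apply]
  simp only [key]
  exact (Function.bijective_iff_existsUnique _).1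
    ⟨Matrix.vecMul_injective_iff_isUnit.2 hdet, Matrix.vecMul_surjective_iff_isUnit.2 hdet⟩ 1

theorem injective_neg_two_pow (n : ℕ) :
    Function.Injective fun k : Fin n => -(2 : ℝ) ^ (k : ℕ) := fun i j h =>
  Fin.ext (pow_right_injective₀ two_pos (by norm_num) (neg_injective h))

/-- the one-dimensional reflection-extension construction of Lemma 4.1.
(a) There are unique reals `b_0,…,b_m` with `∑_k b_k (−2^k)^j = 1` for all `j ≤ m`.
(b) With these `b_k`, for every `f` that is `C^m` on `[0,1]`, the reflected extension
`g` (equal to `f` on `[0,1]` and to `∑_k b_k f(−2^k x)` for `x < 0`) is `C^m` on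
`[−2^{−m},1]`, with derivatives up to order `m` bounded by `K_m` times any uniform
bound on the derivatives of `f` up to order `m`. -/
theorem stmt_10 (m : ℕ) :
    ∃ b : Fin (m + 1) → ℝ,
      (∀ j : Fin (m + 1),
        ∑ k : Fin (m + 1), b k * (-(2 : ℝ) ^ (k : ℕ)) ^ (j : ℕ) = 1) ∧
      (∀ b' : Fin (m + 1) → ℝ,
        (∀ j : Fin (m + 1),
          ∑ k : Fin (m + 1), b' k * (-(2 : ℝ) ^ (k : ℕ)) ^ (j : ℕ) = 1) → b' = b) ∧
      ∃ K : ℝ, ∀ f : ℝ → ℝ, ContDiffOn ℝ m f (Set.Icc 0 1) →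
        ContDiffOn ℝ m
          (fun x => if 0 ≤ x then f x
            else ∑ k : Fin (m + 1), b k * f (-(2 : ℝ) ^ (k : ℕ) * x))
          (Set.Icc (-((2 : ℝ) ^ m)⁻¹) 1) ∧
        ∀ M : ℝ,
          (∀ j' ≤ m, ∀ y ∈ Set.Icc (0 : ℝ) 1,
            |iteratedDerivWithin j' f (Set.Icc 0 1) y| ≤ M) →
          ∀ j ≤ m, ∀ x ∈ Set.Icc (-((2 : ℝ) ^ m)⁻¹) (1 : ℝ),
            |iteratedDerivWithin j
              (fun x => if 0 ≤ x then f x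
                else ∑ k : Fin (m + 1), b k * f (-(2 : ℝ) ^ (k : ℕ) * x))
              (Set.Icc (-((2 : ℝ) ^ m)⁻¹) 1) x| ≤ K * M := by
  obtain ⟨b, hb, huniq⟩ := existsUnique_sum_mul_pow_eq_one (injective_neg_two_pow (m + 1))
  have hb' : ∀ j ≤ m, ∑ k : Fin (m + 1), b k * (-(2 : ℝ) ^ (k : ℕ)) ^ j = 1 :=
    fun j hj => hb ⟨j, Nat.lt_succ_of_le hj⟩
  refine ⟨b, hb, huniq, 1 + ∑ k : Fin (m + 1), |b k| * ((2 : ℝ) ^ (k : ℕ)) ^ m,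
    fun f hf => ⟨contDiffOn_reflect hb' hf, fun M hM j hj x hx => ?_⟩⟩
  have hM0 : 0 ≤ M := (abs_nonneg _).trans (hM 0 (Nat.zero_le m) 0 (by simp))
  change |iteratedDerivWithin j (reflect b f) _ x| ≤ _
  rw [iteratedDerivWithin_reflect hb' hf hj hx]
  refine (abs_reflect_le (hM j hj) hx).trans ?_
  simp only [abs_mul, abs_pow, abs_neg, Nat.abs_ofNat]
  gcongr
  exact one_le_pow₀ one_le_two
end

section
/- Let p, q ≥ 1 be integers, ϖ ∈ (0,1], K ≥ 0, L ≥ 0, and let a ∈ ℝ^p, z ∈ ℝ^q. Let H : ℝ^p × ℝ^q → ℝ^p be such that H(ξ, 0) = ξ for all ξ, and for every η the map η ↦ H(a, η) is differentiable with ‖D_η H(a, η)‖ ≤ K·‖a‖^ϖ. Let G : ℝ^p → ℝ^q be Lipschitz with constant L and G(0) = 0, and assume the smallness condition K·‖a‖^ϖ·L ≤ 1/2. If (ξ*, η*) ∈ ℝ^p × ℝ^q satisfies the intersection equations ξ* = H(a, η*) and η* = z + G(ξ*), then ‖ξ* − a‖ ≤ 2K·‖a‖^ϖ·(‖z‖ +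 L·‖a‖) and ‖η* − z‖ ≤ 2L·(‖a‖ + K·‖a‖^ϖ·‖z‖). (This is Lemma E.1 (lem:holo-dist) on the distance between points related by the unstable holonomy, in the coordinates used in its proof.) -/
/-- Lemma E.1 (lem:holo-dist) on the distance between points related by
the unstable holonomy: if `ξ* = H(a, η*)` and `η* = z + G(ξ*)` with `H(ξ,0) = ξ`,
`‖D_η H(a,·)‖ ≤ K‖a‖^ϖ`, `G` Lipschitz with constant `L`, `G 0 = 0`, and
`K‖a‖^ϖ L ≤ 1/2`, then `‖ξ* − a‖ ≤ 2K‖a‖^ϖ (‖z‖ + L‖a‖)` and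
`‖η* − z‖ ≤ 2L (‖a‖ + K‖a‖^ϖ ‖z‖)`. -/
theorem stmt_11 (p q : ℕ) (hp : 1 ≤ p) (hq : 1 ≤ q)
    (ϖ : ℝ) (hϖ0 : 0 < ϖ) (hϖ1 : ϖ ≤ 1)
    (K L : ℝ) (hK : 0 ≤ K) (hL : 0 ≤ L)
    (a : EuclideanSpace ℝ (Fin p)) (z : EuclideanSpace ℝ (Fin q))
    (H : EuclideanSpace ℝ (Fin p) → EuclideanSpace ℝ (Fin q) → EuclideanSpace ℝ (Fin p))
    (hH0 : ∀ ξ, H ξ 0 = ξ)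
    (hHdiff : Differentiable ℝ (H a))
    (hHder : ∀ η, ‖fderiv ℝ (H a) η‖ ≤ K * ‖a‖ ^ ϖ)
    (G : EuclideanSpace ℝ (Fin p) → EuclideanSpace ℝ (Fin q))
    (hGlip : ∀ x y, ‖G x - G y‖ ≤ L * ‖x - y‖) (hG0 : G 0 = 0)
    (hsmall : K * ‖a‖ ^ ϖ * L ≤ 1 / 2)
    (ξs : EuclideanSpace ℝ (Fin p)) (ηs : EuclideanSpace ℝ (Fin q))
    (hξ : ξs = H a ηs) (hη : ηs = z + G ξs) :
    ‖ξs - a‖ ≤ 2 * K * ‖a‖ ^ ϖ * (‖z‖ + L * ‖a‖) ∧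
    ‖ηs - z‖ ≤ 2 * L * (‖a‖ + K * ‖a‖ ^ ϖ * ‖z‖) := by
  have hc : 0 ≤ K * ‖a‖ ^ ϖ := by positivity
  have hx : ‖ξs - a‖ ≤ K * ‖a‖ ^ ϖ * ‖ηs‖ := by
    have h := convex_univ.norm_image_sub_le_of_norm_fderiv_le (𝕜 := ℝ) (f := H a)
      (fun η _ => hHdiff η) (fun η _ => hHder η) (Set.mem_univ 0) (Set.mem_univ ηs)
    rwa [hH0, ← hξ, sub_zero] at h
  have hy : ‖ηs - z‖ ≤ L * ‖ξs‖ := by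
    have h := hGlip ξs 0
    rwa [hG0, sub_zero, sub_zero, ← add_sub_cancel_left z (G ξs), ← hη] at h
  have hξn : ‖ξs‖ ≤ ‖a‖ + ‖ξs - a‖ := norm_le_norm_add_norm_sub' ξs a
  have hηn : ‖ηs‖ ≤ ‖z‖ + ‖ηs - z‖ := norm_le_norm_add_norm_sub' ηs z
  rw [mul_assoc 2 K]
  generalize K * ‖a‖ ^ ϖ = c at *
  have hxs := mul_le_mul_of_nonneg_right hsmall (norm_nonneg (ξs - a))
  have hys := mul_le_mul_of_nonneg_right hsmall (norm_nonneg (ηs - z))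
  constructor
  · have h : ‖ξs - a‖ ≤ c * (‖z‖ + L * (‖a‖ + ‖ξs - a‖)) := by
      refine hx.trans (mul_le_mul_of_nonneg_left ?_ hc)
      linarith [mul_le_mul_of_nonneg_left hξn hL]
    linarith
  · have h : ‖ηs - z‖ ≤ L * (‖a‖ + c * (‖z‖ + ‖ηs - z‖)) := by
      refine hy.trans (mul_le_mul_of_nonneg_left ?_ hL)
      linarith [mul_le_mul_of_nonneg_left hηn hc]
    linarith
end
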